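/- arXiv:1504.05229 — 5 statements merged into one kernel-verified Lean document; each statement's English description precedes it below -/
import Mathlib

section
/- Let 0 < β ≤ α and set T = (α−β)²/(8β). Then for any two matrices P, Q ∈ ℝ^{d₁×d₂} all of whose entries lie in [β, α], one has d_H²(P,Q) ≥ ((1−e^{−T})/(4αT))·‖P−Q‖_F²/(d₁d₂). -/
open scoped BigOperators

/-- The squared Frobenius norm of a real matrix. -/
def frobSq {d₁ d₂ : ℕ} (X : Matrix (Fin d₁) (Fin d₂) ℝ) : ℝ :=
  ∑ i, ∑ j, (X i j) ^ 2

/-- The average squared Hellinger distance between the entrywise Poisson distributions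
determined by two positive matrices `P, Q`. -/
noncomputable def hellingerSq {d₁ d₂ : ℕ} (P Q : Matrix (Fin d₁) (Fin d₂) ℝ) : ℝ :=
  (1 / ((d₁ : ℝ) * d₂)) * ∑ i, ∑ j,
    (2 - 2 * Real.exp (-(1 / 2) * (Real.sqrt (P i j) - Real.sqrt (Q i j)) ^ 2))

/-- Chord bound for the concave function `s ↦ 1 - exp (-s)` on `[0, T]`. -/
theorem one_sub_exp_neg_div_mul_le {s T : ℝ} (hs : 0 ≤ s) (hsT : s ≤ T) :
    (1 - Real.exp (-T)) / T * s ≤ 1 - Real.exp (-s) := by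
  rcases (hs.trans hsT).eq_or_lt with rfl | hT
  · simpa using hs
  have hconv := convexOn_exp.2 (Set.mem_univ 0) (Set.mem_univ (-T))
    (sub_nonneg.2 ((div_le_one hT).2 hsT)) (div_nonneg hs hT.le) (sub_add_cancel 1 (s / T))
  simp only [smul_eq_mul, mul_zero, zero_add, Real.exp_zero, mul_one] at hconv
  have hs_eq : s / T * -T = -s := by field_simp
  have hchord : (1 - Real.exp (-T)) / T * s = s / T - s / T * Real.exp (-T) := by ring
  rw [hs_eq] at hconv
  linarith

/-- The squared Hellinger distance between two Poisson distributions with parameters in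
`[β, α]` dominates a multiple of the squared difference of the parameters. -/
theorem poisson_hellinger_lower_bound {α β p q : ℝ} (hβ : 0 < β)
    (hp : β ≤ p ∧ p ≤ α) (hq : β ≤ q ∧ q ≤ α) :
    (1 - Real.exp (-((α - β) ^ 2 / (8 * β)))) / (4 * α * ((α - β) ^ 2 / (8 * β))) * (p - q) ^ 2 ≤
      2 - 2 * Real.exp (-(1 / 2) * (Real.sqrt p - Real.sqrt q) ^ 2) := by
  obtain ⟨hβp, hpα⟩ := hp
  obtain ⟨hβq, hqα⟩ := hq
  have hα : 0 < α := hβ.trans_le (hβp.trans hpα)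
  set T := (α - β) ^ 2 / (8 * β) with hT
  have hT0 : 0 ≤ T := by positivity
  set a := Real.sqrt p
  set b := Real.sqrt q
  have ha : 0 ≤ a := Real.sqrt_nonneg p
  have hb : 0 ≤ b := Real.sqrt_nonneg q
  have hpa : a ^ 2 = p := Real.sq_sqrt (hβ.le.trans hβp)
  have hqb : b ^ 2 = q := Real.sq_sqrt (hβ.le.trans hβq)
  have hfactor : (p - q) ^ 2 = (a - b) ^ 2 * (a + b) ^ 2 := by rw [← hpa, ← hqb]; ring
  have hsum_le : (a + b) ^ 2 ≤ 4 * α := by nlinarith [sq_nonneg (a - b)]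
  have hle_sum : 4 * β ≤ (a + b) ^ 2 := by
    have hβab : β ≤ a * b := by
      rw [← Real.sqrt_mul (hβ.le.trans hβp)]
      exact Real.le_sqrt_of_sq_le (by nlinarith)
    nlinarith
  have hdiff : (p - q) ^ 2 ≤ (α - β) ^ 2 := sq_le_sq' (by linarith) (by linarith)
  have hsT : 1 / 2 * (a - b) ^ 2 ≤ T := by
    rw [hT, le_div_iff₀ (by positivity)]
    nlinarith [mul_le_mul_of_nonneg_left hle_sum (sq_nonneg (a - b))]
  have hs : (p - q) ^ 2 / (8 * α) ≤ 1 / 2 * (a - b) ^ 2 := by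
    rw [div_le_iff₀ (by positivity)]
    nlinarith [mul_le_mul_of_nonneg_left hsum_le (sq_nonneg (a - b))]
  have hslope : 0 ≤ (1 - Real.exp (-T)) / T :=
    div_nonneg (sub_nonneg.2 (Real.exp_le_one_iff.2 (neg_nonpos.2 hT0))) hT0
  have hchord := one_sub_exp_neg_div_mul_le (by positivity) hsT
  calc (1 - Real.exp (-T)) / (4 * α * T) * (p - q) ^ 2
      = 2 * ((1 - Real.exp (-T)) / T * ((p - q) ^ 2 / (8 * α))) := by
        simp only [div_eq_mul_inv, mul_inv]
        ring
    _ ≤ 2 * ((1 - Real.exp (-T)) / T * (1 / 2 * (a - b) ^ 2)) := by gcongr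
    _ ≤ 2 * (1 - Real.exp (-(1 / 2 * (a - b) ^ 2))) := by gcongr
    _ = 2 - 2 * Real.exp (-(1 / 2) * (a - b) ^ 2) := by rw [neg_mul]; ring

/-- Let `0 < β ≤ α` and `T = (α−β)²/(8β)`. For any two `d₁ × d₂` matrices `P, Q`
all of whose entries lie in `[β, α]`, the average squared Hellinger distance satisfies
`d_H²(P,Q) ≥ ((1−e^{−T})/(4αT))·‖P−Q‖_F²/(d₁d₂)`. -/
theorem hellinger_matrix_lower_bound (d₁ d₂ : ℕ) (hd₁ : 0 < d₁) (hd₂ : 0 < d₂)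
    (α β : ℝ) (hβ : 0 < β) (hβα : β ≤ α)
    (T : ℝ) (hT : T = (α - β) ^ 2 / (8 * β))
    (P Q : Matrix (Fin d₁) (Fin d₂) ℝ)
    (hP : ∀ i j, β ≤ P i j ∧ P i j ≤ α) (hQ : ∀ i j, β ≤ Q i j ∧ Q i j ≤ α) :
    (1 - Real.exp (-T)) / (4 * α * T) * (frobSq (P - Q) / ((d₁ : ℝ) * d₂)) ≤
      hellingerSq P Q := by
  subst hT
  rw [frobSq, hellingerSq, div_eq_mul_one_div (∑ i, _), ← mul_assoc, mul_comm]
  refine mul_le_mul_of_nonneg_left ?_ (by positivity)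
  simp only [Finset.mul_sum]
  exact Finset.sum_le_sum fun i _ => Finset.sum_le_sum fun j _ =>
    poisson_hellinger_lower_bound hβ (hP i j) (hQ i j)
end

section
/- Let 0 < β ≤ α and set T = (α−β)²/(8β). Then for all real numbers x, y with β ≤ x ≤ α and β ≤ y ≤ α, one has 2 − 2·exp(−(1/2)(√x − √y)²) ≥ ((1−e^{−T})/(4αT))·(x−y)². -/
/-- The chord of the concave function `u ↦ 1 - exp (-u)` over `[0, T]` lies below its graph. -/
theorem one_sub_exp_neg_div_mul_le_s8 {u T : ℝ} (hu : 0 ≤ u) (huT : u ≤ T) (hT : 0 < T) :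
    (1 - Real.exp (-T)) / T * u ≤ 1 - Real.exp (-u) := by
  have h := convexOn_exp.2 (Set.mem_univ 0) (Set.mem_univ (-T))
    (sub_nonneg.2 ((div_le_one hT).2 huT)) (div_nonneg hu hT.le) (sub_add_cancel 1 (u / T))
  have e : (1 - u / T) • (0 : ℝ) + (u / T) • (-T) = -u := by
    simp only [smul_eq_mul]
    field_simp
    ring
  rw [e] at h
  simp only [smul_eq_mul, Real.exp_zero] at h
  linear_combination h

/-- Let `0 < β ≤ α` and `T = (α−β)²/(8β)`. Then for all `x, y ∈ [β, α]`,
the squared Hellinger distance between Poisson(x) and Poisson(y),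
`2 − 2·exp(−(1/2)(√x − √y)²)`, is at least `((1−e^{−T})/(4αT))·(x−y)²`. -/
theorem hellinger_sq_lower_bound (α β : ℝ) (hβ : 0 < β) (hβα : β ≤ α)
    (T : ℝ) (hT : T = (α - β) ^ 2 / (8 * β)) :
    ∀ x y : ℝ, β ≤ x → x ≤ α → β ≤ y → y ≤ α →
      (1 - Real.exp (-T)) / (4 * α * T) * (x - y) ^ 2 ≤
        2 - 2 * Real.exp (-(1 / 2) * (Real.sqrt x - Real.sqrt y) ^ 2) := by
  intro x y hx hxα hy hyα
  have hα : 0 < α := hβ.trans_le hβα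
  have hT0 : 0 ≤ T := by rw [hT]; positivity
  rw [neg_mul]
  rcases hT0.eq_or_lt with h0 | hTpos
  · rw [← h0]
    have : Real.exp (-(1 / 2 * (√x - √y) ^ 2)) ≤ 1 :=
      Real.exp_le_one_iff.2 (neg_nonpos.2 (by positivity))
    simp only [mul_zero, div_zero, zero_mul]
    linarith
  have hxs : √x ^ 2 = x := Real.sq_sqrt (hβ.le.trans hx)
  have hys : √y ^ 2 = y := Real.sq_sqrt (hβ.le.trans hy)
  have hfac : (x - y) ^ 2 = (√x - √y) ^ 2 * (√x + √y) ^ 2 := by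
    rw [← mul_pow, mul_comm (√x - √y), ← sq_sub_sq, hxs, hys]
  have hupper : (√x + √y) ^ 2 ≤ 4 * α := by nlinarith [sq_nonneg (√x - √y)]
  have hlower : 4 * β ≤ (√x + √y) ^ 2 := by
    have : β ≤ √x * √y := by
      rw [← Real.mul_self_sqrt hβ.le]
      gcongr
    nlinarith
  have huT : 1 / 2 * (√x - √y) ^ 2 ≤ T := by
    have hxy : (x - y) ^ 2 ≤ (α - β) ^ 2 := sq_le_sq' (by linarith) (by linarith)
    have := mul_le_mul_of_nonneg_left hlower (sq_nonneg (√x - √y))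
    rw [hT, le_div_iff₀ (by positivity)]
    linarith
  have hchord := one_sub_exp_neg_div_mul_le_s8 (by positivity) huT hTpos
  have hc : 0 ≤ (1 - Real.exp (-T)) / T :=
    div_nonneg (sub_nonneg.2 (Real.exp_le_one_iff.2 (neg_nonpos.2 hT0))) hT0
  have hd : (x - y) ^ 2 / (4 * α) ≤ (√x - √y) ^ 2 := by
    rw [div_le_iff₀ (by positivity), hfac]
    gcongr
  calc (1 - Real.exp (-T)) / (4 * α * T) * (x - y) ^ 2
      = (1 - Real.exp (-T)) / T * ((x - y) ^ 2 / (4 * α)) := by field_simp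
    _ ≤ (1 - Real.exp (-T)) / T * (√x - √y) ^ 2 := by gcongr
    _ ≤ 2 - 2 * Real.exp (-(1 / 2 * (√x - √y) ^ 2)) := by linarith
end

section
/- Let α > 0 and let Y be a Poisson random variable with mean λ where 0 < λ ≤ α. Set t₀ = α(e² − 3). Then for all t ≥ t₀, P(Y − λ ≥ t) ≤ e^{−t}. -/
open ProbabilityTheory

/-- The series defining the moment generating function of the Poisson distribution. -/
theorem hasSum_poissonMeasure_mul_exp (r : NNReal) (s : ℝ) :
    HasSum (fun n : ℕ ↦ Real.exp (-r) * (r : ℝ) ^ n / (n.factorial : ℝ) * Real.exp (s * n))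
      (Real.exp (r * (Real.exp s - 1))) := by
  have h := (NormedSpace.expSeries_div_hasSum_exp ((r : ℝ) * Real.exp s)).mul_left
    (Real.exp (-r))
  rw [← Real.exp_eq_exp_ℝ, ← Real.exp_add] at h
  convert! h using 1
  · ext n
    rw [mul_pow, ← Real.exp_nat_mul, mul_comm s]
    ring
  · congr 1
    ring

theorem integrable_exp_mul_poissonMeasure (r : NNReal) (s : ℝ) :
    MeasureTheory.Integrable (fun n : ℕ ↦ Real.exp (s * n)) (poissonMeasure r) := by
  rw [integrable_poissonMeasure_iff]
  simpa using (hasSum_poissonMeasure_mul_exp r s).summable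

theorem mgf_poissonMeasure (r : NNReal) (s : ℝ) :
    mgf (fun n : ℕ ↦ (n : ℝ)) (poissonMeasure r) s = Real.exp (r * (Real.exp s - 1)) := by
  rw [mgf, integral_poissonMeasure]
  simpa using (hasSum_poissonMeasure_mul_exp r s).tsum_eq

/-- Let `α > 0` and let `Y ~ Poisson(λ)` with `0 < λ ≤ α`.
Set `t₀ = α(e² − 3)`. Then for all `t ≥ t₀`, `P(Y − λ ≥ t) ≤ e^{−t}`. -/
theorem poisson_tail_bound (α : ℝ) (hα : 0 < α) (lam : NNReal) (hlam : 0 < lam)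
    (hlamα : (lam : ℝ) ≤ α) :
    ∀ t : ℝ, α * (Real.exp 2 - 3) ≤ t →
      poissonMeasure lam {n : ℕ | t ≤ (n : ℝ) - (lam : ℝ)} ≤ ENNReal.ofReal (Real.exp (-t)) := by
  intro t ht
  have h := measure_ge_le_exp_mul_mgf (t + lam) zero_le_two
    (integrable_exp_mul_poissonMeasure lam 2)
  rw [mgf_poissonMeasure, ← Real.exp_add] at h
  have hexp : (3 : ℝ) ≤ Real.exp 2 := by linarith [Real.add_one_le_exp (2 : ℝ)]
  have hmul : lam * (Real.exp 2 - 3) ≤ α * (Real.exp 2 - 3) :=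
    mul_le_mul_of_nonneg_right hlamα (sub_nonneg.2 hexp)
  simp only [le_sub_iff_add_le]
  rw [← MeasureTheory.ofReal_measureReal]
  refine ENNReal.ofReal_le_ofReal (h.trans (Real.exp_le_exp.2 ?_))
  linarith
end

section
/- Let d₁, d₂, r ∈ ℕ with r ≥ 1, and let S_r = {X ∈ ℝ^{d₁×d₂} : rank(X) ≤ r and ‖X‖_F = 1}. Then for every ε ∈ (0, 9] there exists a subset S̄_r ⊆ S_r which is an ε-net of S_r with respect to the Frobenius norm (i.e., for every V ∈ S_r there exists V₀ ∈ S̄_r with ‖V₀ − V‖_F ≤ ε), and whose cardinality satisfies |S̄_r| ≤ (9/ε)^{(d₁+d₂+1)r}. -/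
open scoped BigOperators

/-- The Frobenius norm of a real matrix. -/
noncomputable def frobNorm {d₁ d₂ : ℕ} (X : Matrix (Fin d₁) (Fin d₂) ℝ) : ℝ :=
  Real.sqrt (∑ i, ∑ j, (X i j) ^ 2)

open Metric Set MeasureTheory Module
open scoped ENNReal NNReal

section Covering

variable {E : Type*} [NormedAddCommGroup E] [NormedSpace ℝ E] [FiniteDimensional ℝ E]

/-- Volume bound for a separated subset of the unit ball. -/
theorem card_le_of_norm_le_one_of_separated (s : Finset E) {δ : ℝ} (hδ : 0 < δ)
    (hs : ∀ c ∈ s, ‖c‖ ≤ 1) (h : ∀ c ∈ s, ∀ d ∈ s, c ≠ d → δ ≤ ‖c - d‖) :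
    (s.card : ℝ) ≤ (1 + 2 / δ) ^ finrank ℝ E := by
  borelize E
  let μ : Measure E := Measure.addHaar
  have hδ2 : 0 < δ / 2 := by positivity
  have hρ : 0 < 1 + δ / 2 := by positivity
  have hdisj : Set.Pairwise (s : Set E) (Function.onFun Disjoint fun c => ball (c : E) (δ / 2)) := by
    rintro c hc d hd hcd
    apply ball_disjoint_ball
    rw [dist_eq_norm, add_halves]
    exact h c hc d hd hcd
  have hsub : (⋃ c ∈ s, ball (c : E) (δ / 2)) ⊆ ball (0 : E) (1 + δ / 2) := by
    refine iUnion₂_subset fun x hx => ball_subset_ball' ?_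
    rw [dist_zero_right]
    linarith [hs x hx]
  have hvol : (s.card : ℝ≥0∞) * ENNReal.ofReal ((δ / 2) ^ finrank ℝ E) * μ (ball 0 1) ≤
      ENNReal.ofReal ((1 + δ / 2) ^ finrank ℝ E) * μ (ball 0 1) :=
    calc
      _ = μ (⋃ c ∈ s, ball (c : E) (δ / 2)) := by
        rw [measure_biUnion_finset hdisj fun c _ => measurableSet_ball]
        simp only [μ.addHaar_ball_of_pos _ hδ2, Finset.sum_const, nsmul_eq_mul, mul_assoc]
      _ ≤ μ (ball (0 : E) (1 + δ / 2)) := measure_mono hsub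
      _ = _ := by simp only [μ.addHaar_ball_of_pos _ hρ]
  have hcard : (s.card : ℝ≥0∞) * ENNReal.ofReal ((δ / 2) ^ finrank ℝ E) ≤
      ENNReal.ofReal ((1 + δ / 2) ^ finrank ℝ E) :=
    (ENNReal.mul_le_mul_iff_left (measure_ball_pos _ _ zero_lt_one).ne' measure_ball_lt_top.ne).1
      hvol
  have hreal := ENNReal.toReal_le_of_le_ofReal (by positivity) hcard
  rw [ENNReal.toReal_mul, ENNReal.toReal_natCast, ENNReal.toReal_ofReal (by positivity)] at hreal
  have hdiv : 1 + 2 / δ = (1 + δ / 2) / (δ / 2) := by field_simp; ring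
  rwa [hdiv, div_pow, le_div_iff₀ (by positivity)]

/-- Any subset of the unit ball of a finite-dimensional space has an internal `δ`-net of
cardinality at most `(1 + 2 / δ) ^ dim`. -/
theorem exists_net_of_norm_le_one (A : Set E) (hA : ∀ x ∈ A, ‖x‖ ≤ 1) {δ : ℝ} (hδ : 0 < δ) :
    ∃ N ⊆ A, N.Finite ∧ (∀ x ∈ A, ∃ y ∈ N, ‖x - y‖ ≤ δ) ∧
      (N.ncard : ℝ) ≤ (1 + 2 / δ) ^ finrank ℝ E := by
  lift δ to ℝ≥0 using hδ.le
  have : ProperSpace E := FiniteDimensional.proper ℝ E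
  have htb : TotallyBounded A :=
    (isCompact_closedBall (0 : E) 1).totallyBounded.subset fun x hx => by simpa using hA x hx
  have hpack : packingNumber δ A ≠ ⊤ := by
    obtain ⟨C, -, hCfin, hC⟩ := exists_finite_isCover_of_totallyBounded
      (ε := δ / 2) (by have := NNReal.coe_pos.1 hδ; positivity) htb
    have hle := (packingNumber_two_mul_le_externalCoveringNumber (δ / 2) A).trans
      hC.externalCoveringNumber_le_encard
    rw [mul_div_cancel₀ δ two_ne_zero] at hle
    exact ne_top_of_le_ne_top (encard_ne_top_iff.2 hCfin) hle
  have hfin : (maximalSeparatedSet δ A).Finite :=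
    encard_ne_top_iff.1 (by rwa [encard_maximalSeparatedSet hpack])
  refine ⟨maximalSeparatedSet δ A, maximalSeparatedSet_subset, hfin, fun x hx => ?_, ?_⟩
  · have hx' := (isCover_maximalSeparatedSet hpack).subset_iUnion_closedBall hx
    simpa [dist_eq_norm] using hx'
  · rw [ncard_eq_toFinset_card _ hfin]
    refine card_le_of_norm_le_one_of_separated _ hδ (fun c hc => ?_) fun c hc d hd hcd => ?_
    · exact hA c (maximalSeparatedSet_subset (hfin.mem_toFinset.1 hc))
    · have hsep := isSeparated_maximalSeparatedSet (hfin.mem_toFinset.1 hc)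
        (hfin.mem_toFinset.1 hd) hcd
      simp only [edist_nndist, ENNReal.coe_lt_coe] at hsep
      rw [← dist_eq_norm]
      exact_mod_cast hsep.le

end Covering

theorem Submodule.exists_le_finrank_eq {K V : Type*} [DivisionRing K] [AddCommGroup V] [Module K V]
    [FiniteDimensional K V] (S : Submodule K V) {k : ℕ} (hS : finrank K S ≤ k)
    (hk : k ≤ finrank K V) : ∃ T, S ≤ T ∧ finrank K T = k := by
  induction k, hS using Nat.le_induction with
  | base => exact ⟨S, le_rfl, rfl⟩
  | succ m _ ih =>
    obtain ⟨T, hST, hT⟩ := ih (by omega)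
    obtain ⟨v, -, hv⟩ : ∃ v ∈ (⊤ : Submodule K V), v ∉ T := by
      refine SetLike.exists_of_lt (lt_top_iff_ne_top.2 ?_)
      rintro rfl
      rw [finrank_top] at hT
      omega
    refine ⟨T ⊔ Submodule.span K {v}, hST.trans le_sup_left, ?_⟩
    have hv0 : v ≠ 0 := fun h => hv (h ▸ T.zero_mem)
    have hdisj : T ⊓ Submodule.span K {v} = ⊥ :=
      disjoint_iff.1 ((Submodule.disjoint_span_singleton' hv0).2 hv)
    have hsum := Submodule.finrank_sup_add_finrank_inf_eq T (Submodule.span K {v})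
    rwa [hdisj, finrank_bot, add_zero, hT, finrank_span_singleton hv0] at hsum

section Factors

variable {d₁ d₂ k : ℕ}

/-- The columns of a matrix, as a vector whose `ℓ²` norm is the Frobenius norm. -/
noncomputable def columns (X : Matrix (Fin d₁) (Fin d₂) ℝ) :
    PiLp 2 (fun _ : Fin d₂ => EuclideanSpace ℝ (Fin d₁)) :=
  WithLp.toLp 2 fun j => WithLp.toLp 2 fun i => X i j

theorem columns_sub (X Y : Matrix (Fin d₁) (Fin d₂) ℝ) :
    columns (X - Y) = columns X - columns Y := rfl

theorem frobNorm_eq_norm_columns (X : Matrix (Fin d₁) (Fin d₂) ℝ) :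
    frobNorm X = ‖columns X‖ := by
  rw [frobNorm, PiLp.norm_eq_of_L2, Finset.sum_comm]
  simp [EuclideanSpace.norm_sq_eq, columns]

/-- Apply a linear map to each entry of a tuple. -/
noncomputable def mapColumns (U : EuclideanSpace ℝ (Fin k) →L[ℝ] EuclideanSpace ℝ (Fin d₁))
    (B : PiLp 2 (fun _ : Fin d₂ => EuclideanSpace ℝ (Fin k))) :
    PiLp 2 (fun _ : Fin d₂ => EuclideanSpace ℝ (Fin d₁)) :=
  WithLp.toLp 2 fun j => U (B j)

/-- The matrix product of `U` and the matrix with columns `B`. -/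
noncomputable def ofFactors (U : EuclideanSpace ℝ (Fin k) →L[ℝ] EuclideanSpace ℝ (Fin d₁))
    (B : PiLp 2 (fun _ : Fin d₂ => EuclideanSpace ℝ (Fin k))) : Matrix (Fin d₁) (Fin d₂) ℝ :=
  Matrix.of fun i j => U (B j) i

theorem columns_ofFactors (U : EuclideanSpace ℝ (Fin k) →L[ℝ] EuclideanSpace ℝ (Fin d₁))
    (B : PiLp 2 (fun _ : Fin d₂ => EuclideanSpace ℝ (Fin k))) :
    columns (ofFactors U B) = mapColumns U B := rfl

theorem norm_mapColumns_le (U : EuclideanSpace ℝ (Fin k) →L[ℝ] EuclideanSpace ℝ (Fin d₁))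
    (B : PiLp 2 (fun _ : Fin d₂ => EuclideanSpace ℝ (Fin k))) :
    ‖mapColumns U B‖ ≤ ‖U‖ * ‖B‖ := by
  refine le_of_sq_le_sq ?_ (by positivity)
  rw [mul_pow, PiLp.norm_sq_eq_of_L2, PiLp.norm_sq_eq_of_L2, Finset.mul_sum]
  refine Finset.sum_le_sum fun j _ => ?_
  rw [← mul_pow]
  exact pow_le_pow_left₀ (norm_nonneg _) (U.le_opNorm _) 2

theorem norm_mapColumns_of_isometry
    {U : EuclideanSpace ℝ (Fin k) →L[ℝ] EuclideanSpace ℝ (Fin d₁)} (hU : ∀ x, ‖U x‖ = ‖x‖)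
    (B : PiLp 2 (fun _ : Fin d₂ => EuclideanSpace ℝ (Fin k))) :
    ‖mapColumns U B‖ = ‖B‖ := by
  simp [PiLp.norm_eq_of_L2, mapColumns, hU]

theorem frobNorm_ofFactors_sub_le
    {U U' : EuclideanSpace ℝ (Fin k) →L[ℝ] EuclideanSpace ℝ (Fin d₁)} (hU' : ∀ x, ‖U' x‖ = ‖x‖)
    (B B' : PiLp 2 (fun _ : Fin d₂ => EuclideanSpace ℝ (Fin k))) :
    frobNorm (ofFactors U' B' - ofFactors U B) ≤ ‖U - U'‖ * ‖B‖ + ‖B - B'‖ := by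
  have hsplit : mapColumns U' B' - mapColumns U B =
      -(mapColumns (U - U') B + mapColumns U' (B - B')) := by
    ext j i
    simp [mapColumns]
  rw [frobNorm_eq_norm_columns, columns_sub, columns_ofFactors, columns_ofFactors, hsplit, norm_neg,
    ← norm_mapColumns_of_isometry hU' (B - B')]
  exact (norm_add_le _ _).trans (by gcongr; exact norm_mapColumns_le _ _)

theorem rank_ofFactors_le (U : EuclideanSpace ℝ (Fin k) →L[ℝ] EuclideanSpace ℝ (Fin d₁))
    (B : PiLp 2 (fun _ : Fin d₂ => EuclideanSpace ℝ (Fin k))) : (ofFactors U B).rank ≤ k := by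
  have hmul : ofFactors U B =
      Matrix.toEuclideanLin.symm U.toLinearMap * Matrix.of fun i j => B j i := by
    ext i j
    have hj := congrArg (fun f => f (B j) i) (Matrix.toEuclideanLin.apply_symm_apply U.toLinearMap)
    rw [Matrix.toLpLin_apply] at hj
    exact hj.symm
  rw [hmul]
  exact (Matrix.rank_mul_le_left _ _).trans (Matrix.rank_le_width _)

/-- A matrix of rank at most `k` factors through an isometric embedding of `ℝᵏ`. -/
theorem exists_eq_ofFactors (V : Matrix (Fin d₁) (Fin d₂) ℝ) (hV : V.rank ≤ k) (hk : k ≤ d₁) :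
    ∃ (U : EuclideanSpace ℝ (Fin k) →L[ℝ] EuclideanSpace ℝ (Fin d₁))
      (B : PiLp 2 (fun _ : Fin d₂ => EuclideanSpace ℝ (Fin k))),
      (∀ x, ‖U x‖ = ‖x‖) ∧ V = ofFactors U B := by
  have hrank : finrank ℝ (LinearMap.range (Matrix.toEuclideanLin V)) ≤ k := by
    rwa [Matrix.toEuclideanLin, Matrix.toLpLin_eq_toLin, ← Matrix.rank_eq_finrank_range_toLin]
  obtain ⟨T, hT, rfl⟩ := Submodule.exists_le_finrank_eq _ hrank (by simpa using hk)
  let e := (stdOrthonormalBasis ℝ T).repr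
  have hcol (j : Fin d₂) : Matrix.toEuclideanLin V (EuclideanSpace.single j 1) ∈ T :=
    hT (LinearMap.mem_range_self _ _)
  refine ⟨(T.subtypeₗᵢ.comp e.symm.toLinearIsometry).toContinuousLinearMap,
    WithLp.toLp 2 fun j => e ⟨_, hcol j⟩, fun x => LinearIsometry.norm_map _ x, ?_⟩
  ext i j
  simp [ofFactors, Matrix.toLpLin_apply]

end Factors

theorem frobNorm_sub_le {d₁ d₂ : ℕ} (X Y : Matrix (Fin d₁) (Fin d₂) ℝ) :
    frobNorm (X - Y) ≤ frobNorm X + frobNorm Y := by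
  simp only [frobNorm_eq_norm_columns, columns_sub]
  exact norm_sub_le _ _

/-- Nets for the two factors combine to a net for unit matrices of rank at most `k`. -/
theorem exists_net_rank_le {d₁ d₂ k : ℕ} (hk : k ≤ d₁) {ε : ℝ} (hε : 0 < ε) :
    ∃ N : Set (Matrix (Fin d₁) (Fin d₂) ℝ),
      N ⊆ {X | X.rank ≤ k ∧ frobNorm X = 1} ∧
      (∀ V : Matrix (Fin d₁) (Fin d₂) ℝ, V.rank ≤ k → frobNorm V = 1 →
        ∃ V₀ ∈ N, frobNorm (V₀ - V) ≤ ε) ∧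
      N.Finite ∧ (N.ncard : ℝ) ≤ (1 + 4 / ε) ^ ((d₁ + d₂) * k) := by
  obtain ⟨NU, hNU, hNUfin, hUnet, hUcard⟩ := exists_net_of_norm_le_one
    {U : EuclideanSpace ℝ (Fin k) →L[ℝ] EuclideanSpace ℝ (Fin d₁) | ∀ x, ‖U x‖ = ‖x‖}
    (fun U hU => U.opNorm_le_bound zero_le_one fun x => by simpa using (hU x).le) (half_pos hε)
  obtain ⟨NB, hNB, hNBfin, hBnet, hBcard⟩ := exists_net_of_norm_le_one
    {B : PiLp 2 (fun _ : Fin d₂ => EuclideanSpace ℝ (Fin k)) | ‖B‖ = 1}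
    (fun B hB => le_of_eq hB) (half_pos hε)
  have hUdim : finrank ℝ (EuclideanSpace ℝ (Fin k) →L[ℝ] EuclideanSpace ℝ (Fin d₁)) = k * d₁ := by
    rw [← LinearMap.toContinuousLinearMap.finrank_eq, finrank_linearMap]
    simp
  have hBdim : finrank ℝ (PiLp 2 (fun _ : Fin d₂ => EuclideanSpace ℝ (Fin k))) = d₂ * k := by
    rw [(WithLp.linearEquiv 2 ℝ (Fin d₂ → EuclideanSpace ℝ (Fin k))).finrank_eq, finrank_pi_fintype]
    simp
  rw [hUdim] at hUcard
  rw [hBdim] at hBcard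
  refine ⟨image2 ofFactors NU NB, ?_, fun V hV hV1 => ?_, hNUfin.image2 _ hNBfin, ?_⟩
  · rintro _ ⟨U, hU, B, hB, rfl⟩
    refine ⟨rank_ofFactors_le U B, ?_⟩
    rw [frobNorm_eq_norm_columns, columns_ofFactors, norm_mapColumns_of_isometry (hNU hU)]
    exact hNB hB
  · obtain ⟨U, B, hU, rfl⟩ := exists_eq_ofFactors V hV hk
    rw [frobNorm_eq_norm_columns, columns_ofFactors, norm_mapColumns_of_isometry hU] at hV1
    obtain ⟨U', hU', hUU'⟩ := hUnet U hU
    obtain ⟨B', hB', hBB'⟩ := hBnet B hV1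
    refine ⟨_, mem_image2_of_mem hU' hB', (frobNorm_ofFactors_sub_le (hNU hU') B B').trans ?_⟩
    rw [hV1]
    linarith
  · have hle : (image2 ofFactors NU NB).ncard ≤ NU.ncard * NB.ncard := by
      rw [← image_uncurry_prod, ← ncard_prod]
      exact ncard_image_le (hNUfin.prod hNBfin)
    calc ((image2 ofFactors NU NB).ncard : ℝ) ≤ NU.ncard * NB.ncard := by exact_mod_cast hle
      _ ≤ (1 + 2 / (ε / 2)) ^ (k * d₁) * (1 + 2 / (ε / 2)) ^ (d₂ * k) := by gcongr
      _ = (1 + 4 / ε) ^ ((d₁ + d₂) * k) := by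
        rw [← pow_add]
        congr 1
        · field_simp; ring
        · ring

/-- Let `S_r` be the set of `d₁ × d₂` real matrices of rank at most `r` and
unit Frobenius norm. For every `ε ∈ (0, 9]` there is an `ε`-net `S̄_r ⊆ S_r` for the
Frobenius norm with `|S̄_r| ≤ (9/ε)^{(d₁+d₂+1)r}`. -/
theorem covering_number_low_rank (d₁ d₂ r : ℕ) (hr : 1 ≤ r) (ε : ℝ) (hε : 0 < ε) (hε9 : ε ≤ 9) :
    ∃ N : Set (Matrix (Fin d₁) (Fin d₂) ℝ),
      N ⊆ {X | X.rank ≤ r ∧ frobNorm X = 1} ∧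
      (∀ V : Matrix (Fin d₁) (Fin d₂) ℝ, V.rank ≤ r → frobNorm V = 1 →
        ∃ V₀ ∈ N, frobNorm (V₀ - V) ≤ ε) ∧
      N.Finite ∧ (N.ncard : ℝ) ≤ (9 / ε) ^ ((d₁ + d₂ + 1) * r) := by
  have hbase : 1 ≤ 9 / ε := (one_le_div hε).2 hε9
  rcases le_or_gt 2 ε with h2 | h2
  · by_cases hne : ∃ X : Matrix (Fin d₁) (Fin d₂) ℝ, X.rank ≤ r ∧ frobNorm X = 1
    · obtain ⟨X, hX⟩ := hne
      refine ⟨{X}, by simpa using hX, fun V _ hV => ⟨X, rfl, ?_⟩, finite_singleton X, ?_⟩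
      · linarith [frobNorm_sub_le X V, hX.2]
      · simpa using one_le_pow₀ hbase
    · exact ⟨∅, empty_subset _, fun V hVr hV => (hne ⟨V, hVr, hV⟩).elim, finite_empty,
        by simp only [ncard_empty, Nat.cast_zero]; positivity⟩
  · obtain ⟨N, hN, hnet, hfin, hcard⟩ :=
      exists_net_rank_le (d₂ := d₂) (min_le_right r d₁) hε
    refine ⟨N, fun X hX => ⟨(hN hX).1.trans (min_le_left _ _), (hN hX).2⟩,
      fun V hV => hnet V (le_min hV V.rank_le_height), hfin, hcard.trans ?_⟩
    calc (1 + 4 / ε) ^ ((d₁ + d₂) * min r d₁) ≤ (9 / ε) ^ ((d₁ + d₂) * min r d₁) := by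
          gcongr
          rw [le_div_iff₀ hε, add_mul, div_mul_cancel₀ _ hε.ne']
          linarith
      _ ≤ (9 / ε) ^ ((d₁ + d₂ + 1) * r) :=
          pow_le_pow_right₀ hbase (Nat.mul_le_mul (Nat.le_succ _) (min_le_left _ _))
end

section
/- Let S̃ be a nonempty closed convex subset of ℝ^{d₁×d₂}, let f : ℝ^{d₁×d₂} → ℝ be convex and differentiable with gradient satisfying ‖∇f(U) − ∇f(V)‖_F ≤ L‖U − V‖_F for all U, V ∈ S̃ with L > 0, and let M̂ ∈ S̃ be a minimizer of f over S̃. Let X₀ ∈ S̃ and define the proximal-gradient iterates X_k = Π_{S̃}(X_{k−1} − (1/L)∇f(X_{k−1})) for k ≥ 1, where Π_{S̃}(X) = argmin_{Z ∈ S̃} ‖Z − X‖_F² is the orthogonal projection onto S̃. Then for every k ≥ 1, f(X_k) − f(M̂) ≤ L‖X₀ − M̂‖_F²/(2k). -/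
open scoped RealInnerProductSpace

section GradientInequalities

variable {H : Type*} [NormedAddCommGroup H] [InnerProductSpace ℝ H]

/-- Variational inequality for a nearest point of a convex set. -/
theorem Convex.inner_sub_le_zero_of_norm_sub_le {S : Set H} (hS : Convex ℝ S) {x p z : H}
    (hp : p ∈ S) (hmin : ∀ w ∈ S, ‖p - x‖ ≤ ‖w - x‖) (hz : z ∈ S) :
    ⟪x - p, z - p⟫ ≤ 0 := by
  refine (norm_eq_iInf_iff_real_inner_le_zero hS hp).1 ?_ z hz
  have : Nonempty S := ⟨⟨p, hp⟩⟩
  refine le_antisymm (le_ciInf fun w => ?_) ?_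
  · simpa only [norm_sub_rev] using hmin w w.2
  · exact ciInf_le ⟨0, by rintro _ ⟨w, rfl⟩; exact norm_nonneg _⟩ (⟨p, hp⟩ : S)

variable [CompleteSpace H]

/-- Derivative of a differentiable function along an affine line. -/
theorem HasGradientAt.hasDerivAt_comp_line {f : H → ℝ} {g : H → H}
    (hgrad : ∀ x, HasGradientAt f (g x) x) (x v : H) (t : ℝ) :
    HasDerivAt (fun s : ℝ => f (x + s • v)) ⟪g (x + t • v), v⟫ t := by
  have hline : HasDerivAt (fun s : ℝ => x + s • v) v t := by
    simpa using ((hasDerivAt_id t).smul_const v).const_add x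
  simpa [Function.comp_def] using
    (hgrad (x + t • v)).hasFDerivAt.comp_hasDerivAt t hline

/-- A convex differentiable function lies above its tangent hyperplanes. -/
theorem ConvexOn.add_inner_gradient_le {f : H → ℝ} {g : H → H}
    (hconv : ConvexOn ℝ Set.univ f) (hgrad : ∀ x, HasGradientAt f (g x) x) (x y : H) :
    f x + ⟪g x, y - x⟫ ≤ f y := by
  have hline : ConvexOn ℝ Set.univ (fun s : ℝ => f (x + s • (y - x))) := by
    have h := hconv.comp_affineMap (AffineMap.lineMap (k := ℝ) x y)
    simpa [Function.comp_def, AffineMap.lineMap_apply, add_comm] using h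
  have hderiv := HasGradientAt.hasDerivAt_comp_line hgrad x (y - x) 0
  have h := hline.le_slope_of_hasDerivAt (Set.mem_univ 0) (Set.mem_univ 1) one_pos hderiv
  simp [slope_def_field] at h
  linarith

/-- Descent lemma: a function whose gradient is `L`-Lipschitz on a convex set is bounded above
by its quadratic model on that set. -/
theorem Convex.le_add_inner_gradient_add_sq {S : Set H} (hS : Convex ℝ S) {f : H → ℝ}
    {g : H → H} (hgrad : ∀ x, HasGradientAt f (g x) x) {L : ℝ}
    (hlip : ∀ U ∈ S, ∀ V ∈ S, ‖g U - g V‖ ≤ L * ‖U - V‖) {x y : H} (hx : x ∈ S) (hy : y ∈ S) :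
    f y ≤ f x + ⟪g x, y - x⟫ + L / 2 * ‖y - x‖ ^ 2 := by
  set v := y - x with hv
  have hderiv : ∀ t : ℝ, HasDerivAt
      (fun s : ℝ => f (x + s • v) - s * ⟪g x, v⟫ - L / 2 * ‖v‖ ^ 2 * s ^ 2)
      (⟪g (x + t • v), v⟫ - ⟪g x, v⟫ - L * ‖v‖ ^ 2 * t) t := by
    intro t
    have h := ((HasGradientAt.hasDerivAt_comp_line hgrad x v t).sub
      ((hasDerivAt_id t).mul_const ⟪g x, v⟫)).sub
      ((hasDerivAt_pow 2 t).const_mul (L / 2 * ‖v‖ ^ 2))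
    exact h.congr_deriv (by norm_num; ring)
  have hanti : AntitoneOn
      (fun s : ℝ => f (x + s • v) - s * ⟪g x, v⟫ - L / 2 * ‖v‖ ^ 2 * s ^ 2) (Set.Icc 0 1) := by
    refine antitoneOn_of_deriv_nonpos (convex_Icc 0 1)
      (fun t _ => (hderiv t).continuousAt.continuousWithinAt)
      (fun t _ => (hderiv t).differentiableAt.differentiableWithinAt) fun t ht => ?_
    rw [interior_Icc] at ht
    rw [(hderiv t).deriv, ← inner_sub_left]
    have hmem : x + t • v ∈ S := hS.add_smul_sub_mem hx hy ⟨ht.1.le, ht.2.le⟩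
    have hnorm : ‖g (x + t • v) - g x‖ ≤ L * (t * ‖v‖) := by
      simpa [norm_smul, abs_of_pos ht.1] using hlip _ hmem _ hx
    have hinner := real_inner_le_norm (g (x + t • v) - g x) v
    nlinarith [mul_le_mul_of_nonneg_right hnorm (norm_nonneg v)]
  have h := hanti (Set.left_mem_Icc.2 zero_le_one) (Set.right_mem_Icc.2 zero_le_one) zero_le_one
  simp only [one_smul, zero_smul, add_zero, hv, add_sub_cancel] at h
  linarith

/-- One projected gradient step with step size `1 / L`. -/
theorem ConvexOn.projected_gradient_step {S : Set H} (hS : Convex ℝ S) {f : H → ℝ} {g : H → H}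
    (hconv : ConvexOn ℝ Set.univ f) (hgrad : ∀ x, HasGradientAt f (g x) x) {L : ℝ} (hL : 0 < L)
    (hlip : ∀ U ∈ S, ∀ V ∈ S, ‖g U - g V‖ ≤ L * ‖U - V‖) {x p z : H} (hx : x ∈ S) (hp : p ∈ S)
    (hmin : ∀ w ∈ S, ‖p - (x - (1 / L) • g x)‖ ≤ ‖w - (x - (1 / L) • g x)‖) (hz : z ∈ S) :
    f p - f z ≤ L / 2 * (‖x - z‖ ^ 2 - ‖p - z‖ ^ 2) := by
  have hdescent := hS.le_add_inner_gradient_add_sq hgrad hlip hx hp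
  have htangent := hconv.add_inner_gradient_le hgrad x z
  have hvar : L * ⟪x - p, z - p⟫ ≤ ⟪g x, z - p⟫ := by
    have h := hS.inner_sub_le_zero_of_norm_sub_le hp hmin hz
    rw [sub_right_comm, inner_sub_left, real_inner_smul_left, sub_nonpos] at h
    calc L * ⟪x - p, z - p⟫ ≤ L * (1 / L * ⟪g x, z - p⟫) := by gcongr
      _ = ⟪g x, z - p⟫ := by field_simp
  have hsplit : ⟪g x, z - p⟫ = ⟪g x, z - x⟫ - ⟪g x, p - x⟫ := by
    rw [← inner_sub_right, sub_sub_sub_cancel_right]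
  have hpolar : ‖x - z‖ ^ 2 = ‖x - p‖ ^ 2 - 2 * ⟪x - p, z - p⟫ + ‖z - p‖ ^ 2 := by
    rw [← norm_sub_sq_real, sub_sub_sub_cancel_right]
  rw [hpolar, norm_sub_rev p z, norm_sub_rev x p]
  linarith

end GradientInequalities


/-- convergence of proximal gradient descent: Let `S̃` be a nonempty closed
convex subset of `ℝ^{d₁×d₂}` (with the Frobenius inner product), `f` convex and differentiable
with `L`-Lipschitz gradient on `S̃` (`L > 0`), `M̂` a minimizer of `f` over `S̃`, and let
`X_k = Π_{S̃}(X_{k−1} − (1/L)∇f(X_{k−1}))` with `X₀ ∈ S̃`, where `Π_{S̃}` is the orthogonal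
projection onto `S̃`. Then for all `k ≥ 1`, `f(X_k) − f(M̂) ≤ L‖X₀ − M̂‖_F²/(2k)`. -/
theorem proximal_gradient_convergence (d₁ d₂ : ℕ)
    (S : Set (EuclideanSpace ℝ (Fin d₁ × Fin d₂)))
    (hne : S.Nonempty) (hclosed : IsClosed S) (hconvS : Convex ℝ S)
    (f : EuclideanSpace ℝ (Fin d₁ × Fin d₂) → ℝ)
    (g : EuclideanSpace ℝ (Fin d₁ × Fin d₂) → EuclideanSpace ℝ (Fin d₁ × Fin d₂))
    (hconv : ConvexOn ℝ Set.univ f)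
    (hgrad : ∀ x, HasGradientAt f (g x) x)
    (L : ℝ) (hL : 0 < L)
    (hlip : ∀ U ∈ S, ∀ V ∈ S, ‖g U - g V‖ ≤ L * ‖U - V‖)
    (proj : EuclideanSpace ℝ (Fin d₁ × Fin d₂) → EuclideanSpace ℝ (Fin d₁ × Fin d₂))
    (hproj : ∀ x, proj x ∈ S ∧ ∀ z ∈ S, ‖proj x - x‖ ≤ ‖z - x‖)
    (Mhat : EuclideanSpace ℝ (Fin d₁ × Fin d₂)) (hMhat : Mhat ∈ S)
    (hmin : ∀ z ∈ S, f Mhat ≤ f z)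
    (X : ℕ → EuclideanSpace ℝ (Fin d₁ × Fin d₂)) (hX0 : X 0 ∈ S)
    (hiter : ∀ k : ℕ, X (k + 1) = proj (X k - (1 / L) • g (X k))) :
    ∀ k : ℕ, 1 ≤ k → f (X k) - f Mhat ≤ L * ‖X 0 - Mhat‖ ^ 2 / (2 * k) := by
  have hmem : ∀ k, X k ∈ S := by
    rintro (_ | k)
    · exact hX0
    · exact hiter k ▸ (hproj _).1
  have hstep : ∀ k, ∀ z ∈ S,
      f (X (k + 1)) - f z ≤ L / 2 * (‖X k - z‖ ^ 2 - ‖X (k + 1) - z‖ ^ 2) := fun k z hz =>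
    hconv.projected_gradient_step hconvS hgrad hL hlip (hmem k) (hmem (k + 1))
      (hiter k ▸ (hproj _).2) hz
  have hdecr : ∀ k, f (X (k + 1)) ≤ f (X k) := by
    intro k
    have h := hstep k (X k) (hmem k)
    rw [sub_self, norm_zero] at h
    nlinarith [mul_nonneg hL.le (sq_nonneg ‖X (k + 1) - X k‖)]
  have hsum : ∀ k : ℕ,
      k * (f (X k) - f Mhat) ≤ L / 2 * (‖X 0 - Mhat‖ ^ 2 - ‖X k - Mhat‖ ^ 2) := by
    intro k
    induction k with
    | zero => simp
    | succ k ih =>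
      have hk := mul_le_mul_of_nonneg_left (hdecr k) (Nat.cast_nonneg (α := ℝ) k)
      push_cast
      linarith [hstep k Mhat hMhat]
  intro k hk
  have hkpos : (0 : ℝ) < k := by exact_mod_cast hk
  rw [le_div_iff₀ (by positivity)]
  linarith [hsum k, mul_nonneg hL.le (sq_nonneg ‖X k - Mhat‖)]
end
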